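/- For every φ ∈ E of the form φ = 2eᵢ with i odd, or of the form φ = −2eⱼ with j even, and for every ψ ∈ Φ such that ψ ∉ E, ψ ≠ φ and ψ − φ ∉ Φ, there exists ω ∈ E such that either (ω + ψ ∈ Φ and ω + ψ ≠ φ and (ω + ψ) − φ ∉ Φ) or (ω = −ψ and ψ ≠ −φ). -/

import Mathlib

/-- The `i`-th standard basis vector of (an ambient copy of) `ℝ^n`. -/
noncomputable def e (i : ℕ) : ℕ → ℝ := Pi.single i 1

/-- The root system of type `Cₙ`: `{eᵢ - eⱼ, eᵢ + eⱼ, -eᵢ - eⱼ : i ≠ j} ∪ {±2eᵢ}`,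
indices between `1` and `n`. -/
def PhiC (n : ℕ) : Set (ℕ → ℝ) :=
  {v | ∃ i j : ℕ, 1 ≤ i ∧ i ≤ n ∧ 1 ≤ j ∧ j ≤ n ∧ i ≠ j ∧
      (v = e i - e j ∨ v = e i + e j ∨ v = -e i - e j)} ∪
  {v | ∃ i : ℕ, 1 ≤ i ∧ i ≤ n ∧ (v = (2 : ℝ) • e i ∨ v = -((2 : ℝ) • e i))}

/-- The distinguished subset `E ⊆ Φ` of type `Cₙ`:
`{eᵢ - eⱼ : i odd, j even} ∪ {eₘ + eₚ : m ≠ p odd} ∪ {-eₖ - eₗ : k ≠ l even}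
∪ {2eₜ : t odd} ∪ {-2eₛ : s even}`, indices between `1` and `n`. -/
def EC (n : ℕ) : Set (ℕ → ℝ) :=
  {v | ∃ i j : ℕ, 1 ≤ i ∧ i ≤ n ∧ 1 ≤ j ∧ j ≤ n ∧ Odd i ∧ Even j ∧ v = e i - e j} ∪
  {v | ∃ m p : ℕ, 1 ≤ m ∧ m ≤ n ∧ 1 ≤ p ∧ p ≤ n ∧ m ≠ p ∧ Odd m ∧ Odd p ∧
      v = e m + e p} ∪
  {v | ∃ k l : ℕ, 1 ≤ k ∧ k ≤ n ∧ 1 ≤ l ∧ l ≤ n ∧ k ≠ l ∧ Even k ∧ Even l ∧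
      v = -e k - e l} ∪
  {v | ∃ t : ℕ, 1 ≤ t ∧ t ≤ n ∧ Odd t ∧ v = (2 : ℝ) • e t} ∪
  {v | ∃ s : ℕ, 1 ≤ s ∧ s ≤ n ∧ Even s ∧ v = -((2 : ℝ) • e s)}

/-- The signed basis vector `eᵢ` for odd `i` and `-eᵢ` for even `i`. -/
noncomputable def signedE (i : ℕ) : ℕ → ℝ := if Odd i then e i else -e i

theorem signedE_of_odd {i : ℕ} (h : Odd i) : signedE i = e i := if_pos h

theorem signedE_of_even {i : ℕ} (h : Even i) : signedE i = -e i :=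
  if_neg (Nat.not_odd_iff_even.mpr h)

theorem signedE_apply_of_ne {i j : ℕ} (h : i ≠ j) : signedE i j = 0 := by
  unfold signedE
  split_ifs <;> simp [e, h.symm]

theorem abs_signedE_self (i : ℕ) : |signedE i i| = 1 := by
  unfold signedE
  split_ifs <;> simp [e]

theorem signedE_add_mem_EC {n i j : ℕ} (hi : 1 ≤ i) (hin : i ≤ n) (hj : 1 ≤ j) (hjn : j ≤ n) :
    signedE i + signedE j ∈ EC n := by
  rcases Nat.even_or_odd i with pi | pi <;> rcases Nat.even_or_odd j with pj | pj <;>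
    simp only [signedE_of_odd, signedE_of_even, pi, pj]
  · by_cases h : i = j
    · subst h
      exact Or.inr ⟨i, hi, hin, pi, by module⟩
    · exact Or.inl (Or.inl (Or.inr ⟨i, j, hi, hin, hj, hjn, h, pi, pj, by module⟩))
  · exact Or.inl (Or.inl (Or.inl (Or.inl ⟨j, i, hj, hjn, hi, hin, pj, pi, by module⟩)))
  · exact Or.inl (Or.inl (Or.inl (Or.inl ⟨i, j, hi, hin, hj, hjn, pi, pj, by module⟩)))
  · by_cases h : i = j
    · subst h
      exact Or.inl (Or.inr ⟨i, hi, hin, pi, by module⟩)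
    · exact Or.inl (Or.inl (Or.inl (Or.inr ⟨i, j, hi, hin, hj, hjn, h, pi, pj, rfl⟩)))

theorem EC_subset_PhiC (n : ℕ) : EC n ⊆ PhiC n := by
  rintro v ((((⟨i, j, hi, hin, hj, hjn, pi, pj, rfl⟩ | ⟨i, j, hi, hin, hj, hjn, h, -, -, rfl⟩) |
    ⟨i, j, hi, hin, hj, hjn, h, -, -, rfl⟩) | ⟨i, hi, hin, -, rfl⟩) | ⟨i, hi, hin, -, rfl⟩)
  · refine Or.inl ⟨i, j, hi, hin, hj, hjn, ?_, Or.inl rfl⟩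
    rintro rfl
    exact Nat.not_odd_iff_even.mpr pj pi
  · exact Or.inl ⟨i, j, hi, hin, hj, hjn, h, Or.inr (Or.inl rfl)⟩
  · exact Or.inl ⟨i, j, hi, hin, hj, hjn, h, Or.inr (Or.inr rfl)⟩
  · exact Or.inr ⟨i, hi, hin, Or.inl rfl⟩
  · exact Or.inr ⟨i, hi, hin, Or.inr rfl⟩

theorem neg_mem_PhiC {n : ℕ} {v : ℕ → ℝ} (hv : v ∈ PhiC n) : -v ∈ PhiC n := by
  rcases hv with ⟨i, j, hi, hin, hj, hjn, h, rfl | rfl | rfl⟩ | ⟨i, hi, hin, rfl | rfl⟩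
  · exact Or.inl ⟨j, i, hj, hjn, hi, hin, h.symm, Or.inl (by module)⟩
  · exact Or.inl ⟨i, j, hi, hin, hj, hjn, h, Or.inr (Or.inr (by module))⟩
  · exact Or.inl ⟨i, j, hi, hin, hj, hjn, h, Or.inr (Or.inl (by module))⟩
  · exact Or.inr ⟨i, hi, hin, Or.inr rfl⟩
  · exact Or.inr ⟨i, hi, hin, Or.inl (by module)⟩

theorem signedE_sub_mem_PhiC {n i j : ℕ} (hi : 1 ≤ i) (hin : i ≤ n) (hj : 1 ≤ j) (hjn : j ≤ n)
    (h : i ≠ j) : signedE i - signedE j ∈ PhiC n := by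
  rcases Nat.even_or_odd i with pi | pi <;> rcases Nat.even_or_odd j with pj | pj <;>
    simp only [signedE_of_odd, signedE_of_even, pi, pj]
  · exact Or.inl ⟨j, i, hj, hjn, hi, hin, h.symm, Or.inl (by module)⟩
  · exact Or.inl ⟨i, j, hi, hin, hj, hjn, h, Or.inr (Or.inr rfl)⟩
  · exact Or.inl ⟨i, j, hi, hin, hj, hjn, h, Or.inr (Or.inl (by module))⟩
  · exact Or.inl ⟨i, j, hi, hin, hj, hjn, h, Or.inl rfl⟩

theorem PhiC_cases {n : ℕ} {v : ℕ → ℝ} (hv : v ∈ PhiC n) :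
    v ∈ EC n ∨ -v ∈ EC n ∨ ∃ i j, 1 ≤ i ∧ i ≤ n ∧ 1 ≤ j ∧ j ≤ n ∧ i ≠ j ∧
      v = signedE i - signedE j := by
  have key : ∀ i j, 1 ≤ i → i ≤ n → 1 ≤ j → j ≤ n →
      (v = signedE i + signedE j → v ∈ EC n) ∧ (v = -(signedE i + signedE j) → -v ∈ EC n) := by
    intro i j hi hin hj hjn
    refine ⟨?_, ?_⟩ <;> rintro rfl
    · exact signedE_add_mem_EC hi hin hj hjn
    · rw [neg_neg]
      exact signedE_add_mem_EC hi hin hj hjn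
  rcases hv with ⟨i, j, hi, hin, hj, hjn, h, hv⟩ | ⟨i, hi, hin, hv⟩
  · obtain ⟨k₁, k₂⟩ := key i j hi hin hj hjn
    have k₃ : v = signedE i - signedE j → ∃ i j, 1 ≤ i ∧ i ≤ n ∧ 1 ≤ j ∧ j ≤ n ∧ i ≠ j ∧
      v = signedE i - signedE j := fun hv => ⟨i, j, hi, hin, hj, hjn, h, hv⟩
    have k₄ : v = signedE j - signedE i → ∃ i j, 1 ≤ i ∧ i ≤ n ∧ 1 ≤ j ∧ j ≤ n ∧ i ≠ j ∧
      v = signedE i - signedE j := fun hv => ⟨j, i, hj, hjn, hi, hin, h.symm, hv⟩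
    rcases Nat.even_or_odd i with pi | pi <;> rcases Nat.even_or_odd j with pj | pj <;>
      simp only [signedE_of_odd, signedE_of_even, pi, pj] at k₁ k₂ k₃ k₄ <;>
      rcases hv with rfl | rfl | rfl <;>
      first
        | exact Or.inl (k₁ (by module))
        | exact Or.inr (Or.inl (k₂ (by module)))
        | exact Or.inr (Or.inr (k₃ (by module)))
        | exact Or.inr (Or.inr (k₄ (by module)))
  · obtain ⟨k₁, k₂⟩ := key i i hi hin hi hin
    rcases Nat.even_or_odd i with pi | pi <;>
      simp only [signedE_of_odd, signedE_of_even, pi] at k₁ k₂ <;>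
      rcases hv with rfl | rfl <;>
      first
        | exact Or.inl (k₁ (by module))
        | exact Or.inr (Or.inl (k₂ (by module)))

theorem abs_add_abs_le_two_of_mem_PhiC {n : ℕ} {v : ℕ → ℝ} (hv : v ∈ PhiC n) {a b : ℕ}
    (hab : a ≠ b) : |v a| + |v b| ≤ 2 := by
  rcases hv with ⟨i, j, -, -, -, -, h, rfl | rfl | rfl⟩ | ⟨i, -, -, rfl | rfl⟩ <;>
    simp only [e, Pi.add_apply, Pi.sub_apply, Pi.neg_apply, Pi.smul_apply, smul_eq_mul,
      Pi.single_apply] <;>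
    split_ifs <;> first | omega | norm_num

/-- Twice a signed basis vector `φ` satisfies the exchange property for every root `ψ`. -/
theorem exists_mem_EC_of_two_smul_signedE {n a : ℕ} (hn : 2 ≤ n) (ha : 1 ≤ a) (han : a ≤ n)
    {ψ : ℕ → ℝ} (hψ : ψ ∈ PhiC n) (hψE : ψ ∉ EC n)
    (hsub : ψ - (2 : ℝ) • signedE a ∉ PhiC n) :
    ∃ ω ∈ EC n,
      (ω + ψ ∈ PhiC n ∧ ω + ψ ≠ (2 : ℝ) • signedE a ∧ (ω + ψ) - (2 : ℝ) • signedE a ∉ PhiC n) ∨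
      (ω = -ψ ∧ ψ ≠ -((2 : ℝ) • signedE a)) := by
  rcases PhiC_cases hψ with h | h | ⟨i, j, hi, hin, hj, hjn, hij, rfl⟩
  · exact absurd h hψE
  · by_cases hψa : ψ = -((2 : ℝ) • signedE a)
    · obtain ⟨b, hb, hbn, hba⟩ : ∃ b, 1 ≤ b ∧ b ≤ n ∧ b ≠ a := by
        by_cases h1 : a = 1
        · exact ⟨2, by omega, hn, by omega⟩
        · exact ⟨1, le_rfl, by omega, by omega⟩
      refine ⟨_, signedE_add_mem_EC hb hbn ha han, Or.inl ?_⟩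
      have hsum : signedE b + signedE a + ψ = signedE b - signedE a := by
        rw [hψa]; module
      rw [hsum]
      refine ⟨signedE_sub_mem_PhiC hb hbn ha han hba, fun heq => ?_, fun hmem => ?_⟩
      · have := congrArg abs (congrFun heq b)
        simp [signedE_apply_of_ne hba.symm, abs_signedE_self] at this
      · have := abs_add_abs_le_two_of_mem_PhiC hmem hba
        have h3 : -signedE a a - 2 * signedE a a = -3 * signedE a a := by ring
        simp [signedE_apply_of_ne hba, signedE_apply_of_ne hba.symm, abs_signedE_self, h3,
          abs_mul] at this
        norm_num at this
    · exact ⟨-ψ, h, Or.inr ⟨rfl, hψa⟩⟩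
  · have hia : i ≠ a := by
      rintro rfl
      refine hsub ?_
      have := neg_mem_PhiC (EC_subset_PhiC n (signedE_add_mem_EC hi hin hj hjn))
      convert this using 1
      module
    refine ⟨_, signedE_add_mem_EC hi hin hj hjn, Or.inl ?_⟩
    have hsum : signedE i + signedE j + (signedE i - signedE j) = signedE i + signedE i := by
      module
    rw [hsum]
    refine ⟨EC_subset_PhiC n (signedE_add_mem_EC hi hin hi hin), fun heq => ?_, fun hmem => ?_⟩
    · have := congrArg abs (congrFun heq i)
      simp [signedE_apply_of_ne hia.symm, ← two_mul, abs_mul, abs_signedE_self] at this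
    · have := abs_add_abs_le_two_of_mem_PhiC hmem hia
      simp [signedE_apply_of_ne hia, signedE_apply_of_ne hia.symm, ← two_mul, abs_mul,
        abs_signedE_self] at this

/-- Case 3 of the proof of Lemma A.2 of the paper: `φ = 2eᵢ` with `i` odd,
or `φ = -2eⱼ` with `j` even. -/
theorem stmt_5 (n : ℕ) (hn : 3 ≤ n) :
    ∀ φ : ℕ → ℝ,
      ((∃ i : ℕ, 1 ≤ i ∧ i ≤ n ∧ Odd i ∧ φ = (2 : ℝ) • e i) ∨
        (∃ j : ℕ, 1 ≤ j ∧ j ≤ n ∧ Even j ∧ φ = -((2 : ℝ) • e j))) →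
      ∀ ψ ∈ PhiC n, ψ ∉ EC n → ψ ≠ φ → ψ - φ ∉ PhiC n →
        ∃ ω ∈ EC n,
          (ω + ψ ∈ PhiC n ∧ ω + ψ ≠ φ ∧ (ω + ψ) - φ ∉ PhiC n) ∨
          (ω = -ψ ∧ ψ ≠ -φ) := by
  intro φ hφ ψ hψ hψE _ hsub
  obtain ⟨a, ha, han, rfl⟩ : ∃ a, 1 ≤ a ∧ a ≤ n ∧ φ = (2 : ℝ) • signedE a := by
    rcases hφ with ⟨i, hi, hin, pi, rfl⟩ | ⟨j, hj, hjn, pj, rfl⟩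
    · exact ⟨i, hi, hin, by rw [signedE_of_odd pi]⟩
    · exact ⟨j, hj, hjn, by rw [signedE_of_even pj, smul_neg]⟩
  exact exists_mem_EC_of_two_smul_signedE (by omega) ha han hψ hψE hsub
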